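/- (Gilbert–Sonthalia, corollary.) Let G be a finite connected weighted graph with positive edge weights w that is chordal (every cycle of length at least four has a chord) and in which no 3-cycle is broken (on every triangle, each edge weight is at most the sum of the other two). Then the shortest-path distances d_G form a metric on the vertex set of G that extends the given edge weights: d_G is symmetric, satisfies the triangle inequality, d_G(u,u) = 0, d_G(u,v) > 0 for u ≠ v, and d_G(u,v) = w(u,v) whenever {u,v} is an edge of G. In particular, the partial distance information given by the edge weights of G can be completed into a metric. -/

import Mathlib

open SimpleGraph

/-- The weight of a walk: the sum of the weights of its edges. -/
def walkWeight {V : Type*} {G : SimpleGraph V} (w : Sym2 V → ℝ) {u v : V}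
    (p : G.Walk u v) : ℝ :=
  (p.edges.map w).sum

/-- The shortest-path distance between `u` and `v` in the weighted graph `(G, w)`:
the infimum over all paths from `u` to `v` of the sum of the weights of their edges. -/
noncomputable def spDist {V : Type*} (G : SimpleGraph V) (w : Sym2 V → ℝ) (u v : V) : ℝ :=
  sInf {x : ℝ | ∃ p : G.Walk u v, p.IsPath ∧ walkWeight w p = x}

/-- A chord of a cycle `p` in `G`: an edge of `G` joining two vertices of the cycle that are
not consecutive on the cycle (equivalently, an edge of `G` between vertices of the cycle
that is not an edge of the cycle). -/
def HasChord {V : Type*} (G : SimpleGraph V) {v : V} (p : G.Walk v v) : Prop :=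
  ∃ e ∈ G.edgeSet, e ∉ p.edges ∧ ∀ x ∈ e, x ∈ p.support

/-- A graph is chordal if every cycle of length at least four has a chord. -/
def IsChordalGraph {V : Type*} (G : SimpleGraph V) : Prop :=
  ∀ (v : V) (p : G.Walk v v), p.IsCycle → 4 ≤ p.length → HasChord G p

section ShortestPath

variable {V : Type*} {G : SimpleGraph V} {w : Sym2 V → ℝ}

@[simp] lemma walkWeight_nil (u : V) : walkWeight w (Walk.nil : G.Walk u u) = 0 := by
  simp [walkWeight]

@[simp] lemma walkWeight_cons {u v x : V} (h : G.Adj u v) (p : G.Walk v x) :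
    walkWeight w (Walk.cons h p) = w s(u, v) + walkWeight w p := by
  simp [walkWeight]

@[simp] lemma walkWeight_append {u v x : V} (p : G.Walk u v) (q : G.Walk v x) :
    walkWeight w (p.append q) = walkWeight w p + walkWeight w q := by
  simp [walkWeight]

@[simp] lemma walkWeight_reverse {u v : V} (p : G.Walk u v) :
    walkWeight w p.reverse = walkWeight w p := by
  simp [walkWeight]

lemma walkWeight_nonneg (hpos : ∀ e ∈ G.edgeSet, 0 < w e) {u v : V} (p : G.Walk u v) :
    0 ≤ walkWeight w p := by
  refine List.sum_nonneg fun a ha ↦ ?_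
  obtain ⟨e, he, rfl⟩ := List.mem_map.1 ha
  exact (hpos e (p.edges_subset_edgeSet he)).le

lemma walkWeight_pos (hpos : ∀ e ∈ G.edgeSet, 0 < w e) {u v : V} (huv : u ≠ v)
    (p : G.Walk u v) : 0 < walkWeight w p := by
  cases p with
  | nil => exact absurd rfl huv
  | cons h p =>
    rw [walkWeight_cons]
    exact add_pos_of_pos_of_nonneg (hpos _ h) (walkWeight_nonneg hpos p)

lemma walkWeight_bypass_le [DecidableEq V] (hpos : ∀ e ∈ G.edgeSet, 0 < w e) {u v : V}
    (p : G.Walk u v) : walkWeight w p.bypass ≤ walkWeight w p := by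
  refine (p.edges_bypass_sublist_edges.map w).sum_le_sum fun a ha ↦ ?_
  obtain ⟨e, he, rfl⟩ := List.mem_map.1 ha
  exact (hpos e (p.edges_subset_edgeSet he)).le

lemma spDist_le_walkWeight (hpos : ∀ e ∈ G.edgeSet, 0 < w e) {u v : V} (p : G.Walk u v) :
    spDist G w u v ≤ walkWeight w p := by
  classical
  refine le_trans (b := walkWeight w p.bypass) ?_ (walkWeight_bypass_le hpos p)
  refine csInf_le ⟨0, ?_⟩ ⟨p.bypass, p.bypass_isPath, rfl⟩
  rintro _ ⟨q, -, rfl⟩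
  exact walkWeight_nonneg hpos q

lemma exists_isPath_walkWeight_eq_spDist [Finite V] (hconn : G.Connected) (w : Sym2 V → ℝ)
    (u v : V) : ∃ p : G.Walk u v, p.IsPath ∧ walkWeight w p = spDist G w u v := by
  classical
  have := Fintype.ofFinite V
  let S : Set ℝ := {x | ∃ p : G.Walk u v, p.IsPath ∧ walkWeight w p = x}
  have hfin : S.Finite :=
    (Set.finite_range fun p : G.Path u v ↦ walkWeight w (p : G.Walk u v)).subset <| by
      rintro _ ⟨p, hp, rfl⟩
      exact ⟨⟨p, hp⟩, rfl⟩
  obtain ⟨p⟩ := hconn.preconnected u v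
  have hne : S.Nonempty := ⟨walkWeight w p.bypass, p.bypass, p.bypass_isPath, rfl⟩
  exact hne.csInf_mem hfin

/-- A chord splits a path into two shorter walks, each completed by an edge. -/
lemma weight_le_walkWeight_of_shortcut (hpos : ∀ e ∈ G.edgeSet, 0 < w e) {u v x y : V}
    (huv : G.Adj u v) (hxy : G.Adj x y) (p₁ : G.Walk u x) (p₂ : G.Walk x y) (p₃ : G.Walk y v)
    (hp : (p₁.append (p₂.append p₃)).IsPath)
    (hne : s(x, y) ≠ s(u, v)) (hmem : s(x, y) ∉ p₂.edges)
    (ih : ∀ {a b : V} (q : G.Walk a b), q.IsPath → G.Adj a b →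
      q.length < (p₁.append (p₂.append p₃)).length → w s(a, b) ≤ walkWeight w q) :
    w s(u, v) ≤ walkWeight w (p₁.append (p₂.append p₃)) := by
  classical
  have hlen : (p₁.append (p₂.append p₃)).length = p₁.length + (p₂.length + p₃.length) := by
    simp
  have h₂ : w s(x, y) ≤ walkWeight w p₂ := by
    refine ih p₂ hp.of_append_right.of_append_left hxy ?_
    rw [hlen]
    by_contra! hle
    have hux : u = x := Walk.eq_of_length_eq_zero (p := p₁) (by lia)
    have hyv : y = v := Walk.eq_of_length_eq_zero (p := p₃) (by lia)
    exact hne (by rw [hux, hyv])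
  have hlen₂ : 2 ≤ p₂.length := by
    cases p₂ with
    | nil => exact absurd rfl hxy.ne
    | cons h p =>
      cases p with
      | nil => simp at hmem
      | cons h' p => simp
  let q : G.Walk u v := p₁.append (Walk.cons hxy p₃)
  have hq : w s(u, v) ≤ walkWeight w q.bypass := by
    refine ih q.bypass q.bypass_isPath huv (q.length_bypass_le_length.trans_lt ?_)
    rw [hlen]
    simp only [q, Walk.length_append, Walk.length_cons]
    lia
  refine hq.trans ((walkWeight_bypass_le hpos q).trans ?_)
  simp only [q, walkWeight_append, walkWeight_cons]
  linarith

lemma exists_shortcut {u v x y : V} (p : G.Walk u v) (hx : x ∈ p.support) (hy : y ∈ p.support) :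
    (∃ (p₁ : G.Walk u x) (p₂ : G.Walk x y) (p₃ : G.Walk y v), p = p₁.append (p₂.append p₃)) ∨
    (∃ (p₁ : G.Walk u y) (p₂ : G.Walk y x) (p₃ : G.Walk x v), p = p₁.append (p₂.append p₃)) := by
  classical
  obtain ⟨q, r, rfl⟩ := Walk.mem_support_iff_exists_append.1 hx
  rcases (Walk.mem_support_append_iff q r).1 hy with h | h
  · obtain ⟨s, t, rfl⟩ := Walk.mem_support_iff_exists_append.1 h
    exact .inr ⟨s, t, r, by rw [Walk.append_assoc]⟩
  · obtain ⟨s, t, rfl⟩ := Walk.mem_support_iff_exists_append.1 h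
    exact .inl ⟨q, s, t, rfl⟩

lemma weight_le_walkWeight_of_isPath (hpos : ∀ e ∈ G.edgeSet, 0 < w e)
    (hchordal : IsChordalGraph G)
    (htri : ∀ u v z : V, G.Adj u v → G.Adj v z → G.Adj u z →
      w s(u, v) ≤ w s(u, z) + w s(z, v))
    {u v : V} (p : G.Walk u v) (hp : p.IsPath) (huv : G.Adj u v) :
    w s(u, v) ≤ walkWeight w p := by
  induction hn : p.length using Nat.strong_induction_on generalizing u v p with
  | _ n ih =>
  subst hn
  have ih' : ∀ {a b : V} (q : G.Walk a b), q.IsPath → G.Adj a b → q.length < p.length →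
      w s(a, b) ≤ walkWeight w q := fun q hq hab hlt ↦ ih _ hlt q hq hab rfl
  by_cases hmem : s(u, v) ∈ p.edges
  · refine List.single_le_sum (fun a ha ↦ ?_) _ (List.mem_map_of_mem hmem)
    obtain ⟨e, he, rfl⟩ := List.mem_map.1 ha
    exact (hpos e (p.edges_subset_edgeSet he)).le
  by_cases hlen : p.length ≤ 2
  · match p, hlen with
    | .nil, _ => exact absurd rfl huv.ne
    | .cons h .nil, _ => simp at hmem
    | .cons (v := z) h (.cons h' .nil), _ => simpa using htri u v z huv h'.symm h
    | .cons _ (.cons _ (.cons _ _)), hlen => simp at hlen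
  · have hcyc : (Walk.cons huv.symm p).IsCycle :=
      (Walk.cons_isCycle_iff p huv.symm).2 ⟨hp, by rwa [Sym2.eq_swap]⟩
    obtain ⟨e, he, hep, hsupp⟩ :=
      hchordal v (Walk.cons huv.symm p) hcyc (by rw [Walk.length_cons]; lia)
    induction e using Sym2.ind with
    | _ x y =>
    rw [Walk.edges_cons, List.mem_cons, not_or, Sym2.eq_swap (a := v)] at hep
    have hs : ∀ z ∈ s(x, y), z ∈ p.support := fun z hz ↦ by
      rcases List.mem_cons.1 (hsupp z hz) with rfl | h
      · exact p.end_mem_support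
      · exact h
    rcases exists_shortcut p (hs x (Sym2.mem_mk_left x y)) (hs y (Sym2.mem_mk_right x y)) with
      ⟨p₁, p₂, p₃, rfl⟩ | ⟨p₁, p₂, p₃, rfl⟩
    · refine weight_le_walkWeight_of_shortcut hpos huv he p₁ p₂ p₃ hp hep.1 ?_ ih'
      exact fun h ↦ hep.2 (by simp [h])
    · rw [Sym2.eq_swap] at hep
      refine weight_le_walkWeight_of_shortcut hpos huv he.symm p₁ p₂ p₃ hp hep.1 ?_ ih'
      exact fun h ↦ hep.2 (by simp [h])

lemma spDist_le_spDist_swap [Finite V] (hconn : G.Connected)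
    (hpos : ∀ e ∈ G.edgeSet, 0 < w e) (u v : V) : spDist G w u v ≤ spDist G w v u := by
  obtain ⟨p, -, hp⟩ := exists_isPath_walkWeight_eq_spDist hconn w v u
  rw [← hp, ← walkWeight_reverse]
  exact spDist_le_walkWeight hpos _

end ShortestPath

/-- (Gilbert–Sonthalia, corollary) In a finite connected chordal graph with positive edge
weights in which no 3-cycle is broken, the shortest-path distances form a metric on the
vertex set that extends the given edge weights. -/
theorem stmt_11 {V : Type*} [Fintype V] (G : SimpleGraph V) (w : Sym2 V → ℝ)
    (hconn : G.Connected)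
    (hpos : ∀ e ∈ G.edgeSet, 0 < w e)
    (hchordal : IsChordalGraph G)
    (htri : ∀ u v z : V, G.Adj u v → G.Adj v z → G.Adj u z →
      w s(u, v) ≤ w s(u, z) + w s(z, v)) :
    (∀ u v : V, spDist G w u v = spDist G w v u) ∧
    (∀ u v z : V, spDist G w u v ≤ spDist G w u z + spDist G w z v) ∧
    (∀ u : V, spDist G w u u = 0) ∧
    (∀ u v : V, u ≠ v → 0 < spDist G w u v) ∧
    (∀ u v : V, G.Adj u v → spDist G w u v = w s(u, v)) := by
  refine ⟨fun u v ↦ (spDist_le_spDist_swap hconn hpos u v).antisymm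
    (spDist_le_spDist_swap hconn hpos v u), fun u v z ↦ ?_, fun u ↦ ?_, fun u v huv ↦ ?_,
    fun u v huv ↦ ?_⟩
  · obtain ⟨p, -, hp⟩ := exists_isPath_walkWeight_eq_spDist hconn w u z
    obtain ⟨q, -, hq⟩ := exists_isPath_walkWeight_eq_spDist hconn w z v
    rw [← hp, ← hq, ← walkWeight_append]
    exact spDist_le_walkWeight hpos _
  · obtain ⟨p, hp, h⟩ := exists_isPath_walkWeight_eq_spDist hconn w u u
    rw [← h, (Walk.isPath_iff_nil.1 hp).eq_nil, walkWeight_nil]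
  · obtain ⟨p, -, h⟩ := exists_isPath_walkWeight_eq_spDist hconn w u v
    rw [← h]
    exact walkWeight_pos hpos huv p
  · obtain ⟨p, hp, h⟩ := exists_isPath_walkWeight_eq_spDist hconn w u v
    refine le_antisymm ?_ (h ▸ weight_le_walkWeight_of_isPath hpos hchordal htri p hp huv)
    simpa using spDist_le_walkWeight hpos huv.toWalk
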